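/- Let m ≥ 2 and let DA_{2m} = ⟨a,b ∣ (ab)^m = (ba)^m⟩ be the even dihedral Artin group with label 2m. Suppose H is a subgroup of Out(DA_{2m}) that fixes the cyclic subgroup ⟨b⟩ up to conjugation, i.e., every element of H has an automorphism representative ψ of DA_{2m} such that ψ(⟨b⟩) = g⟨b⟩g⁻¹ for some g ∈ DA_{2m}. Then H is finite. -/

import Mathlib

/-- The single relation `(ab)^m = (ba)^m` of the even dihedral Artin group
`DA_{2m} = ⟨a,b ∣ (ab)^m = (ba)^m⟩`, with `a = true` and `b = false`. -/
def evenDihedralArtinRels (m : ℕ) : Set (FreeGroup Bool) :=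
  {(FreeGroup.of true * FreeGroup.of false) ^ m *
    ((FreeGroup.of false * FreeGroup.of true) ^ m)⁻¹}

/-- The even dihedral Artin group `DA_{2m} = ⟨a,b ∣ (ab)^m = (ba)^m⟩`. -/
abbrev EvenDihedralArtinGroup (m : ℕ) : Type := PresentedGroup (evenDihedralArtinRels m)

/-- The standard generator `a` of `DA_{2m}`. -/
def aGen (m : ℕ) : EvenDihedralArtinGroup m := PresentedGroup.of true

/-- The standard generator `b` of `DA_{2m}`. -/
def bGen (m : ℕ) : EvenDihedralArtinGroup m := PresentedGroup.of false

/-- The subgroup of inner automorphisms of a group. -/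
def innerAutSubgroup (G : Type*) [Group G] : Subgroup (MulAut G) :=
  (MulAut.conj (G := G)).range

instance innerAutSubgroup_normal (G : Type*) [Group G] : (innerAutSubgroup G).Normal := by
  constructor
  rintro f ⟨g, rfl⟩ φ
  refine ⟨φ g, ?_⟩
  ext x
  simp only [MulAut.conj_apply, MulAut.mul_apply, MulAut.inv_def, map_mul, map_inv,
    MulEquiv.apply_symm_apply]

/-- The outer automorphism group of a group: the quotient of the automorphism group by the
normal subgroup of inner automorphisms. -/
abbrev Out (G : Type*) [Group G] : Type _ := MulAut G ⧸ innerAutSubgroup G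

namespace FreeGroup

variable {α : Type*}

theorem IsReduced.invRev {L : List (α × Bool)} (h : IsReduced L) :
    IsReduced (FreeGroup.invRev L) := by
  classical
  rw [isReduced_iff_reduce_eq] at h ⊢
  rw [reduce_invRev, h]

theorem head?_invRev (L : List (α × Bool)) :
    (FreeGroup.invRev L).head? = L.getLast?.map fun g => (g.1, !g.2) := by
  simp [FreeGroup.invRev]

theorem getLast?_invRev (L : List (α × Bool)) :
    (FreeGroup.invRev L).getLast? = L.head?.map fun g => (g.1, !g.2) := by
  simp [FreeGroup.invRev]

theorem IsReduced.append {L₁ L₂ : List (α × Bool)} (h₁ : IsReduced L₁) (h₂ : IsReduced L₂)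
    (h : ∀ x ∈ L₁.getLast?, ∀ y ∈ L₂.head?, x.1 = y.1 → x.2 = y.2) : IsReduced (L₁ ++ L₂) :=
  List.IsChain.append h₁ h₂ h

theorem IsReduced.map_equiv {L : List (α × Bool)} (h : IsReduced L) (e : α ≃ α) :
    IsReduced (L.map (Prod.map e id)) := by
  unfold IsReduced at h ⊢
  rw [List.isChain_map]
  simpa using h

theorem map_equiv_eq_mk (e : α ≃ α) (x : FreeGroup α) [DecidableEq α] :
    map e x = mk (x.toWord.map (Prod.map e id)) := by
  conv_lhs => rw [← mk_toWord (x := x)]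
  rfl

theorem toWord_map_equiv [DecidableEq α] (e : α ≃ α) (x : FreeGroup α) :
    (map e x).toWord = x.toWord.map (Prod.map e id) := by
  rw [map_equiv_eq_mk, toWord_mk, (isReduced_toWord.map_equiv e).reduce_eq]

/-- An element of a free group commuting with two distinct generators is trivial. -/
theorem eq_one_of_commute_of {i j : α} (hij : i ≠ j) {x : FreeGroup α}
    (hi : Commute (of i) x) (hj : Commute (of j) x) : x = 1 := by
  classical
  rw [← toWord_eq_nil_iff]
  rcases hL : x.toWord with _ | ⟨a, L⟩
  · rfl
  exfalso
  have key : ∀ k, Commute (of k) x → a.1 = k := by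
    intro k hk
    by_contra hak
    have h1 : (of k * x).toWord = (k, true) :: a :: L := by
      rw [toWord_mul, toWord_of, hL]
      apply IsReduced.reduce_eq
      have := isReduced_toWord (x := x)
      rw [hL] at this
      simp only [List.singleton_append, isReduced_cons_cons]
      exact ⟨fun h => absurd h.symm hak, this⟩
    have h2 : (x * of k).toWord.Sublist (a :: L ++ [(k, true)]) := by
      have := toWord_mul_sublist x (of k)
      rwa [hL, toWord_of] at this
    rw [← hk.eq, h1] at h2
    have := h2.eq_of_length (by simp)
    simp only [List.cons_append, List.cons.injEq] at this
    exact hak (by rw [← this.1])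
  exact hij ((key i hi).symm.trans (key j hj))

/-- Every element of a free group is `u * (of i) ^ k` where `u` does not end in the letter `i`. -/
theorem exists_eq_mul_of_zpow [DecidableEq α] (i : α) (x : FreeGroup α) :
    ∃ (u : FreeGroup α) (k : ℤ), x = u * of i ^ k ∧ ∀ y ∈ u.toWord.getLast?, y.1 ≠ i := by
  suffices H : ∀ L : List (α × Bool), IsReduced L → ∃ (M : List (α × Bool)) (k : ℤ),
      IsReduced M ∧ mk L = mk M * of i ^ k ∧ ∀ y ∈ M.getLast?, y.1 ≠ i by
    obtain ⟨M, k, hM, h, hy⟩ := H x.toWord isReduced_toWord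
    refine ⟨mk M, k, by rw [← h, mk_toWord], ?_⟩
    rwa [toWord_mk, hM.reduce_eq]
  intro L
  induction L using List.reverseRecOn with
  | nil => exact fun _ => ⟨[], 0, by simp, by simp [← one_eq_mk], by simp⟩
  | append_singleton L a ih =>
    intro hL
    by_cases ha : a.1 = i
    · obtain ⟨M, k, hM, h, hy⟩ := ih (List.IsChain.left_of_append hL)
      obtain ⟨a1, a2⟩ := a
      obtain rfl : a1 = i := ha
      refine ⟨M, k + (if a2 then 1 else -1), hM, ?_, hy⟩
      rw [← mul_mk, h, mul_assoc, zpow_add]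
      cases a2
      · simp [of, inv_mk]
        rfl
      · simp [of]
    · exact ⟨L ++ [a], 0, hL, by simp, by simpa using ha⟩

/-- The partial norms `x * T x * T² x * ⋯` (with `n` factors) of an element `x` of a group with
an automorphism `T`. -/
def twistedPow {G : Type*} [Group G] (T : MulAut G) (x : G) : ℕ → G
  | 0 => 1
  | n + 1 => x * T (twistedPow T x n)

theorem twistedPow_conj {G : Type*} [Group G] (T : MulAut G) (x c : G) (n : ℕ) :
    twistedPow T (c⁻¹ * x * T c) n = c⁻¹ * twistedPow T x n * (T ^ n) c := by
  induction n with
  | zero => simp [twistedPow]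
  | succ n ih =>
    simp only [twistedPow, ih, _root_.map_mul, _root_.map_inv, pow_succ', MulAut.mul_apply]
    simp only [mul_assoc, mul_inv_cancel_left]

/-- A cyclic group of order `n` permuting a basis of a free group has trivial first cohomology:
elements of trivial norm are coboundaries. -/
theorem exists_eq_mul_inv_of_twistedPow_eq_one (e : α ≃ α) {n : ℕ} (hn : n ≠ 0)
    (hT : (freeGroupCongr e : MulAut (FreeGroup α)) ^ n = 1) (w : FreeGroup α)
    (hw : twistedPow (freeGroupCongr e : MulAut (FreeGroup α)) w n = 1) :
    ∃ v, w = v * (freeGroupCongr e v)⁻¹ := by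
  classical
  set T : MulAut (FreeGroup α) := freeGroupCongr e with hTdef
  have hTw : ∀ x, (T x).toWord = x.toWord.map (Prod.map e id) := toWord_map_equiv e
  induction hk : w.toWord.length using Nat.strong_induction_on generalizing w with
  | _ k ih =>
  rcases hL : w.toWord with _ | ⟨c, L⟩
  · exact ⟨1, by rw [toWord_eq_nil_iff] at hL; simp [hL]⟩
  have hwred : IsReduced (c :: L) := hL ▸ isReduced_toWord
  by_cases hjunc : ∀ x ∈ (c :: L).getLast?, x.1 = e c.1 → x.2 = c.2
  · exfalso
    have key : ∀ n, ∃ R, (twistedPow T w (n + 1)).toWord = c :: L ++ R := by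
      intro n
      induction n with
      | zero => exact ⟨[], by simp [twistedPow, hL]⟩
      | succ n ihn =>
        obtain ⟨R, hR⟩ := ihn
        refine ⟨(c :: L ++ R).map (Prod.map e id), ?_⟩
        rw [twistedPow, toWord_mul, hTw, hR, hL]
        apply IsReduced.reduce_eq
        refine hwred.append ((hR ▸ isReduced_toWord).map_equiv e) ?_
        intro x hx y hy
        simp only [List.cons_append, List.map_cons, List.head?_cons, Option.mem_def,
          Option.some.injEq] at hy
        subst hy
        exact hjunc x hx
    obtain ⟨n, rfl⟩ := Nat.exists_eq_succ_of_ne_zero hn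
    obtain ⟨R, hR⟩ := key n
    rw [hw] at hR
    simp at hR
  · push Not at hjunc
    obtain ⟨x, hx, hx1, hx2⟩ := hjunc
    obtain ⟨M, rfl⟩ : ∃ M, L = M ++ [x] := by
      rcases List.eq_nil_or_concat' L with rfl | ⟨M, y, rfl⟩
      · simp at hx
        exact absurd (by rw [hx]) hx2
      · rw [← List.cons_append, List.getLast?_concat] at hx
        exact ⟨M, by simp at hx; rw [hx]⟩
    have hwc : w = mk [c] * mk M * (T (mk [c]))⁻¹ := by
      rw [← mk_toWord (x := w), hL]
      have : (T (mk [c]))⁻¹ = mk [x] := by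
        change (mk [(e c.1, c.2)])⁻¹ = _
        rw [inv_mk]
        congr 1
        simp only [FreeGroup.invRev, List.map_cons, List.map_nil, List.reverse_singleton]
        rw [← hx1, ← Bool.eq_not.mpr hx2]
      rw [this]
      rfl
    have hMw : mk M = (mk [c])⁻¹ * w * T (mk [c]) := by
      generalize mk [c] = d at hwc ⊢
      rw [hwc]
      group
    have hMred : IsReduced M := List.IsChain.left_of_append (List.IsChain.tail hwred)
    obtain ⟨v, hv⟩ := ih M.length (by rw [← hk, hL]; simp) (mk M)
      (by rw [hMw, twistedPow_conj, hw, hT, mul_one, MulAut.one_apply, inv_mul_cancel])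
      (by rw [toWord_mk, hMred.reduce_eq])
    exact ⟨mk [c] * v, by rw [hwc, hv, _root_.map_mul]; group⟩

/-- If words `U i` have nothing to cancel with `i` and have distinct first letters, then the
endomorphism sending each `i` to its conjugate by `U i` strictly increases lengths. -/
theorem exists_lift_conj_eq [DecidableEq α] (U : α → List (α × Bool))
    (hred : ∀ i, IsReduced (U i)) (hlast : ∀ i, ∀ x ∈ (U i).getLast?, x.1 ≠ i)
    (hhead : ∀ i j, i ≠ j → ∀ x ∈ (U i).head?, ∀ y ∈ (U j).head?, x.1 ≠ y.1)
    (hne : ∀ i, U i ≠ []) (i : α) (s : Bool) (L : List (α × Bool))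
    (hL : IsReduced ((i, s) :: L)) :
    ∃ R, IsReduced (U i ++ (i, s) :: R) ∧
      lift (fun i => mk (U i) * of i * (mk (U i))⁻¹) (mk ((i, s) :: L)) =
        mk (U i ++ (i, s) :: R) := by
  set f : FreeGroup α →* FreeGroup α := lift (fun i => mk (U i) * of i * (mk (U i))⁻¹) with hf
  have hf1 : ∀ i s, f (mk [(i, s)]) = mk (U i ++ (i, s) :: FreeGroup.invRev (U i)) := by
    intro i s
    have : mk (U i ++ (i, s) :: FreeGroup.invRev (U i)) =
        mk (U i) * mk [(i, s)] * (mk (U i))⁻¹ := by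
      simp [inv_mk]
    rw [this]
    cases s
    · have h2 : (mk [(i, false)] : FreeGroup α) = (of i)⁻¹ := rfl
      rw [h2, _root_.map_inv, hf, lift_apply_of]
      group
    · change f (of i) = _
      rw [hf, lift_apply_of]
      rfl
  have hpre : ∀ i s, IsReduced (U i ++ [(i, s)]) := fun i s =>
    (hred i).append .singleton (by
      intro x hx y hy hxy
      simp at hy
      subst hy
      exact absurd hxy (hlast i x hx))
  have hpost : ∀ i s, IsReduced ([(i, s)] ++ FreeGroup.invRev (U i)) := fun i s =>
    IsReduced.append .singleton (hred i).invRev (by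
      intro x hx y hy hxy
      simp at hx
      subst hx
      rw [head?_invRev] at hy
      simp only [Option.mem_def, Option.map_eq_some_iff] at hy
      obtain ⟨z, hz, rfl⟩ := hy
      exact absurd hxy.symm (hlast i z hz))
  induction L generalizing i s with
  | nil =>
    refine ⟨FreeGroup.invRev (U i), ?_, hf1 i s⟩
    simpa using (hpre i s).append_overlap (hpost i s) (by simp)
  | cons a L ih =>
    obtain ⟨j, t⟩ := a
    rw [isReduced_cons_cons] at hL
    obtain ⟨R, hR, hfR⟩ := ih j t hL.2
    have hsplit : f (mk ((i, s) :: (j, t) :: L)) =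
        mk (U i ++ (i, s) :: FreeGroup.invRev (U i)) * mk (U j ++ (j, t) :: R) := by
      rw [← hfR, ← hf1, ← _root_.map_mul]
      rfl
    by_cases hij : i = j
    · subst hij
      obtain rfl : s = t := hL.1 rfl
      refine ⟨(i, s) :: R, ?_, ?_⟩
      · have h2 : IsReduced ([(i, s)] ++ ((i, s) :: R)) := by
          simp only [List.singleton_append, isReduced_cons_cons, implies_true, true_and]
          exact List.IsChain.right_of_append hR
        simpa using (hpre i s).append_overlap h2 (by simp)
      · rw [hsplit]
        have h1 : mk (U i ++ (i, s) :: FreeGroup.invRev (U i)) =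
          mk (U i) * mk [(i, s)] * (mk (U i))⁻¹ := by simp [inv_mk]
        have h2 : mk (U i ++ (i, s) :: R) = mk (U i) * mk ((i, s) :: R) := by simp
        have h3 : mk (U i ++ (i, s) :: (i, s) :: R) =
          mk (U i) * mk [(i, s)] * mk ((i, s) :: R) := by simp
        rw [h1, h2, h3]
        group
    · refine ⟨FreeGroup.invRev (U i) ++ (U j ++ (j, t) :: R), ?_, ?_⟩
      · have h1 : IsReduced (FreeGroup.invRev (U i) ++ (U j ++ (j, t) :: R)) := by
          refine (hred i).invRev.append hR ?_
          intro x hx y hy hxy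
          rw [getLast?_invRev] at hx
          simp only [Option.mem_def, Option.map_eq_some_iff] at hx
          obtain ⟨z, hz, rfl⟩ := hx
          rw [List.head?_append_of_ne_nil _ (hne j)] at hy
          exact absurd hxy (hhead i j hij z hz y hy)
        have hne' : FreeGroup.invRev (U i) ≠ [] := by
          simpa [FreeGroup.invRev] using hne i
        have h2 := (hpost i s).append_overlap h1 hne'
        simpa using (hpre i s).append_overlap (by simpa using h2) (by simp)
      · rw [hsplit]
        simp

/-- Under the hypotheses of `exists_lift_conj_eq`, no generator is in the range of the
endomorphism. -/
theorem of_notMem_range_lift_conj (U : α → List (α × Bool))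
    (hred : ∀ i, IsReduced (U i)) (hlast : ∀ i, ∀ x ∈ (U i).getLast?, x.1 ≠ i)
    (hhead : ∀ i j, i ≠ j → ∀ x ∈ (U i).head?, ∀ y ∈ (U j).head?, x.1 ≠ y.1)
    (hne : ∀ i, U i ≠ []) (i : α) (x : FreeGroup α) :
    lift (fun i => mk (U i) * of i * (mk (U i))⁻¹) x ≠ of i := by
  classical
  intro h
  rcases hL : x.toWord with _ | ⟨⟨j, s⟩, L⟩
  · rw [toWord_eq_nil_iff] at hL
    rw [hL, _root_.map_one] at h
    exact one_ne_of i h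
  · obtain ⟨R, hR, hfR⟩ := exists_lift_conj_eq U hred hlast hhead hne j s L
      (hL ▸ isReduced_toWord)
    rw [← hL, mk_toWord, h] at hfR
    have := congrArg toWord hfR
    rw [toWord_of, toWord_mk, hR.reduce_eq] at this
    have := congrArg List.length this
    have := List.length_pos_of_ne_nil (hne j)
    simp at *
    omega

end FreeGroup

/-- The action of `ℤ` on the free group on `ZMod m` by cyclically shifting the basis. -/
def cyclicShift (m : ℕ) : Multiplicative ℤ →* MulAut (FreeGroup (ZMod m)) where
  toFun k := FreeGroup.freeGroupCongr (Equiv.addRight (k.toAdd : ZMod m))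
  map_one' := by
    apply MulEquiv.toMonoidHom_injective
    ext i
    simp
  map_mul' j k := by
    apply MulEquiv.toMonoidHom_injective
    ext i
    simp [add_comm, add_left_comm]

theorem cyclicShift_ofAdd_of (m : ℕ) (k : ℤ) (i : ZMod m) :
    cyclicShift m (.ofAdd k) (FreeGroup.of i) = FreeGroup.of (i + k) := rfl

theorem cyclicShift_ofAdd_mul_self (m : ℕ) (k : ℤ) :
    cyclicShift m (.ofAdd (m * k)) = 1 := by
  apply MulEquiv.toMonoidHom_injective
  ext i
  change FreeGroup.of (i + ((m * k : ℤ) : ZMod m)) = FreeGroup.of i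
  simp

/-- The semidirect product of the free group on `ZMod m` with `ℤ` acting by cyclic shifts; it is
isomorphic to `DA_{2m}`. -/
abbrev CyclicShiftGroup (m : ℕ) : Type :=
  FreeGroup (ZMod m) ⋊[cyclicShift m] Multiplicative ℤ

namespace CyclicShiftGroup

open SemidirectProduct

variable {m : ℕ}

variable (m) in
/-- The free generator with index `0`. -/
def base : CyclicShiftGroup m := inl (FreeGroup.of 0)

variable (m) in
/-- The generator of the acting copy of `ℤ`. -/
def shift : CyclicShiftGroup m := inr (.ofAdd 1)

theorem shift_zpow (k : ℤ) : shift m ^ k = inr (.ofAdd k) := by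
  rw [shift, ← map_zpow, ← ofAdd_zsmul]
  simp

theorem inr_mul_inl (k : Multiplicative ℤ) (n : FreeGroup (ZMod m)) :
    (inr k * inl n : CyclicShiftGroup m) = inl (cyclicShift m k n) * inr k := by
  rw [inl_aut]
  simp

theorem shift_zpow_conj_inl_of (k : ℤ) (i : ZMod m) :
    shift m ^ k * inl (FreeGroup.of i) * (shift m ^ k)⁻¹ = inl (FreeGroup.of (i + k)) := by
  rw [shift_zpow, inr_mul_inl, cyclicShift_ofAdd_of, mul_assoc, mul_inv_cancel, mul_one]

theorem inl_of_eq (i : ZMod m) :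
    (inl (FreeGroup.of i) : CyclicShiftGroup m) =
      shift m ^ (i.cast : ℤ) * base m * (shift m ^ (i.cast : ℤ))⁻¹ := by
  rw [base, shift_zpow_conj_inl_of]
  simp

theorem eq_top_of_mem {K : Subgroup (CyclicShiftGroup m)} (hb : base m ∈ K) (hx : shift m ∈ K) :
    K = ⊤ := by
  rw [eq_top_iff]
  intro g _
  rw [← inl_left_mul_inr_right g]
  refine K.mul_mem ?_ ?_
  · have h : (⊤ : Subgroup (FreeGroup (ZMod m))) ≤ K.comap inl := by
      rw [← FreeGroup.closure_range_of, Subgroup.closure_le]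
      rintro _ ⟨i, rfl⟩
      change inl (FreeGroup.of i) ∈ K
      rw [inl_of_eq]
      exact K.mul_mem (K.mul_mem (K.zpow_mem hx _) hb) (K.inv_mem (K.zpow_mem hx _))
    exact h trivial
  · have : inr g.right = shift m ^ g.right.toAdd := by rw [shift_zpow]; rfl
    rw [this]
    exact K.zpow_mem hx _

theorem shift_zpow_mul_self_mem_center (k : ℤ) :
    shift m ^ (m * k) ∈ Subgroup.center (CyclicShiftGroup m) := by
  have h : Subgroup.centralizer {shift m ^ (m * k)} = ⊤ := by
    refine eq_top_of_mem ?_ ?_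
    · rw [Subgroup.mem_centralizer_singleton_iff, shift_zpow, base, inr_mul_inl,
        cyclicShift_ofAdd_mul_self]
      rfl
    · rw [Subgroup.mem_centralizer_singleton_iff]
      exact (Commute.zpow_self _ _).symm.eq
  rw [Subgroup.mem_center_iff]
  intro g
  have : g ∈ Subgroup.centralizer {shift m ^ (m * k)} := h ▸ trivial
  rw [Subgroup.mem_centralizer_singleton_iff] at this
  exact this

theorem inl_mul_inr_pow (w : FreeGroup (ZMod m)) (k : Multiplicative ℤ) (n : ℕ) :
    (inl w * inr k : CyclicShiftGroup m) ^ n =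
      inl (FreeGroup.twistedPow (cyclicShift m k) w n) * inr (k ^ n) := by
  induction n with
  | zero => simp [FreeGroup.twistedPow]
  | succ n ih =>
    rw [pow_succ', ih, FreeGroup.twistedPow, map_mul, pow_succ', map_mul]
    simp only [mul_assoc]
    rw [← mul_assoc (inr k), inr_mul_inl]
    simp only [mul_assoc]

theorem eq_one_of_inl_mem_center [Nontrivial (ZMod m)] {w : FreeGroup (ZMod m)}
    (hw : (inl w : CyclicShiftGroup m) ∈ Subgroup.center _) : w = 1 := by
  rw [Subgroup.mem_center_iff] at hw
  have h : ∀ i, Commute (FreeGroup.of i) w := fun i => by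
    have := hw (inl (FreeGroup.of i))
    rwa [← map_mul, ← map_mul, inl_inj] at this
  exact FreeGroup.eq_one_of_commute_of zero_ne_one (h 0) (h 1)

variable (m) in
/-- The endomorphism fixing `shift` and sending `base` to its conjugate by `u`. -/
def conjBase (u : FreeGroup (ZMod m)) : CyclicShiftGroup m →* CyclicShiftGroup m :=
  SemidirectProduct.map
    (FreeGroup.lift fun i => FreeGroup.map (Equiv.addRight i) u * FreeGroup.of i *
      (FreeGroup.map (Equiv.addRight i) u)⁻¹)
    (MonoidHom.id _) (fun k => by
      have h : ∀ i : ZMod m, cyclicShift m k (FreeGroup.map (Equiv.addRight i) u) =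
          FreeGroup.map (Equiv.addRight (i + k.toAdd)) u := fun i => by
        change FreeGroup.map _ (FreeGroup.map _ u) = _
        rw [FreeGroup.map.comp]
        congr 2
        ext j
        simp [add_assoc]
      ext i
      have hk : cyclicShift m k (FreeGroup.of i) = FreeGroup.of (i + k.toAdd) := rfl
      simp only [MonoidHom.comp_apply, MulEquiv.toMonoidHom_eq_coe, MonoidHom.coe_coe, hk,
        FreeGroup.lift_apply_of, MonoidHom.id_apply, map_mul, map_inv, h])

theorem conjBase_shift (u : FreeGroup (ZMod m)) : conjBase m u (shift m) = shift m := by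
  simp [conjBase, shift]

theorem conjBase_base (u : FreeGroup (ZMod m)) :
    conjBase m u (base m) = inl u * base m * (inl u)⁻¹ := by
  have h : FreeGroup.map (Equiv.addRight (0 : ZMod m)) u = u := by
    simp
  rw [conjBase, base, SemidirectProduct.map_inl, FreeGroup.lift_apply_of, h]
  simp

/-- If `conjBase u` is surjective and `u` does not end in the letter `0`, then `u = 1`. -/
theorem eq_one_of_conjBase_surjective {u : FreeGroup (ZMod m)}
    (hu : ∀ y ∈ u.toWord.getLast?, y.1 ≠ 0) (hs : Function.Surjective (conjBase m u)) :
    u = 1 := by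
  by_contra hne
  obtain ⟨g, hg⟩ := hs (base m)
  have hg' := congrArg SemidirectProduct.left hg
  rw [conjBase, map_left, base, left_inl] at hg'
  simp only [FreeGroup.map_equiv_eq_mk] at hg'
  refine FreeGroup.of_notMem_range_lift_conj
    (fun i : ZMod m => u.toWord.map (Prod.map (Equiv.addRight i) id)) ?_ ?_ ?_ ?_ 0 g.left hg'
  · exact fun i => FreeGroup.isReduced_toWord.map_equiv _
  · intro i x hx
    simp only [List.getLast?_map, Option.mem_def, Option.map_eq_some_iff] at hx
    obtain ⟨y, hy, rfl⟩ := hx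
    simpa using hu y hy
  · intro i j hij x hx y hy
    simp only [List.head?_map, Option.mem_def, Option.map_eq_some_iff] at hx hy
    obtain ⟨z, hz, rfl⟩ := hx
    obtain ⟨z', hz', rfl⟩ := hy
    obtain rfl : z = z' := Option.some_injective _ (hz.symm.trans hz')
    simpa using hij
  · intro i
    simpa using hne

theorem orderOf_base : orderOf (base m) = 0 := by
  rw [base, orderOf_injective inl inl_injective, orderOf_eq_zero_iff]
  intro h
  exact FreeGroup.of_ne_one (0 : ZMod m) h.eq_one'

/-- An automorphism sending `base` to a power of itself sends `shift` to a conjugate, by an element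
whose conjugation does not affect that power, of `shift` or its inverse. -/
theorem exists_conj_of_map_base_eq_zpow (hm : 2 ≤ m) (θ : MulAut (CyclicShiftGroup m)) {ε : ℤ}
    (hθ : θ (base m) = base m ^ ε) :
    ∃ (s : CyclicShiftGroup m) (δ : ℤˣ),
      θ (base m) = s * base m ^ ε * s⁻¹ ∧ θ (shift m) = s * shift m ^ (δ : ℤ) * s⁻¹ := by
  have : Fact (1 < m) := ⟨hm⟩
  obtain ⟨w, d, hwd⟩ : ∃ (w : FreeGroup (ZMod m)) (d : ℤ), θ (shift m) = inl w * shift m ^ d :=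
    ⟨_, (θ (shift m)).right.toAdd, by
      rw [shift_zpow]; exact (inl_left_mul_inr_right _).symm⟩
  have hd : IsUnit d := by
    have htop : (Subgroup.zpowers (Multiplicative.ofAdd d)).comap
        (rightHom.comp θ.toMonoidHom : CyclicShiftGroup m →* Multiplicative ℤ) = ⊤ := by
      refine eq_top_of_mem ?_ ?_
      · have : rightHom (θ (base m)) = 1 := by rw [hθ, base, ← map_zpow, rightHom_inl]
        change rightHom (θ (base m)) ∈ Subgroup.zpowers (Multiplicative.ofAdd d)
        rw [this]
        exact Subgroup.one_mem _
      · change rightHom (θ (shift m)) ∈ Subgroup.zpowers (Multiplicative.ofAdd d)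
        rw [hwd, shift_zpow, map_mul, rightHom_inl, rightHom_inr, one_mul]
        exact Subgroup.mem_zpowers _
    have h1 : θ.symm (shift m) ∈ (Subgroup.zpowers (Multiplicative.ofAdd d)).comap
        (rightHom.comp θ.toMonoidHom : CyclicShiftGroup m →* Multiplicative ℤ) := htop ▸ trivial
    change rightHom (θ (θ.symm (shift m))) ∈ Subgroup.zpowers (Multiplicative.ofAdd d) at h1
    rw [MulEquiv.apply_symm_apply, shift, rightHom_inr] at h1
    obtain ⟨k, hk⟩ := Subgroup.mem_zpowers_iff.mp h1
    have hk' : d * k = 1 := by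
      rw [← ofAdd_zsmul] at hk
      simpa using congrArg Multiplicative.toAdd hk
    exact IsUnit.of_mul_eq_one k hk'
  have hnorm : FreeGroup.twistedPow (cyclicShift m (.ofAdd d)) w m = 1 := by
    apply eq_one_of_inl_mem_center
    have h1 : θ (shift m ^ m) ∈ Subgroup.center (CyclicShiftGroup m) := by
      have h2 := shift_zpow_mul_self_mem_center (m := m) 1
      rw [mul_one, zpow_natCast] at h2
      rw [Subgroup.mem_center_iff] at h2 ⊢
      intro g
      have := congrArg θ (h2 (θ.symm g))
      simpa using this
    have h3 := shift_zpow_mul_self_mem_center (m := m) d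
    rw [map_pow, hwd, shift_zpow, inl_mul_inr_pow, ← ofAdd_nsmul] at h1
    rw [shift_zpow] at h3
    rw [nsmul_eq_mul] at h1
    simpa using Subgroup.mul_mem _ h1 (Subgroup.inv_mem _ h3)
  have hpow : (cyclicShift m (.ofAdd d)) ^ m = 1 := by
    rw [← map_pow, ← ofAdd_nsmul, nsmul_eq_mul, cyclicShift_ofAdd_mul_self]
  obtain ⟨v, hv⟩ := FreeGroup.exists_eq_mul_inv_of_twistedPow_eq_one _ (by omega) hpow w hnorm
  have hx : θ (shift m) = inl v * shift m ^ d * (inl v)⁻¹ := by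
    have hv' : w = v * cyclicShift m (.ofAdd d) v⁻¹ := by rw [map_inv]; exact hv
    rw [hwd, hv', map_mul, mul_assoc, mul_assoc, shift_zpow, ← map_inv, inr_mul_inl]
  obtain ⟨u, k, huk, hu⟩ := FreeGroup.exists_eq_mul_of_zpow 0 v⁻¹
  have hsurj : Function.Surjective (conjBase m u) := by
    have hb : (inl v)⁻¹ * θ (base m) * inl v = inl u * base m ^ ε * (inl u)⁻¹ := by
      have hv1 : (inl v)⁻¹ = inl u * base m ^ k := by
        rw [← map_inv, huk, map_mul, map_zpow]; rfl
      have hv2 : inl v = (inl u * base m ^ k)⁻¹ := by rw [← hv1, inv_inv]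
      rw [hv1, hv2, hθ, mul_inv_rev]
      group
    let θ' : MulAut (CyclicShiftGroup m) := MulAut.conj (inl v)⁻¹ * θ
    have htop : (conjBase m u).range.comap θ'.toMonoidHom = ⊤ := by
      refine eq_top_of_mem ?_ ?_
      · refine ⟨base m ^ ε, ?_⟩
        rw [map_zpow, conjBase_base, conj_zpow, ← hb]
        simp [θ']
      · refine ⟨shift m ^ d, ?_⟩
        rw [map_zpow, conjBase_shift]
        simp [θ', hx, mul_assoc]
    intro g
    have h1 : θ'⁻¹ g ∈ (conjBase m u).range.comap θ'.toMonoidHom := htop ▸ trivial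
    change θ' (θ'⁻¹ g) ∈ (conjBase m u).range at h1
    rwa [MulAut.apply_inv_self] at h1
  rw [eq_one_of_conjBase_surjective hu hsurj, one_mul] at huk
  refine ⟨inl v, hd.unit, ?_, by rw [hx, hd.unit_spec]⟩
  have hvb : inl v = base m ^ (-k) := by
    rw [zpow_neg, base, ← map_zpow, ← huk, map_inv, inv_inv]
  rw [hθ, hvb]
  group

theorem exists_conj_of_map_zpowers (hm : 2 ≤ m) (θ : MulAut (CyclicShiftGroup m))
    (g : CyclicShiftGroup m)
    (hθ : (Subgroup.zpowers (base m)).map θ.toMonoidHom =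
      (Subgroup.zpowers (base m)).map (MulAut.conj g).toMonoidHom) :
    ∃ (s : CyclicShiftGroup m) (ε δ : ℤˣ),
      θ (base m) = s * base m ^ (ε : ℤ) * s⁻¹ ∧ θ (shift m) = s * shift m ^ (δ : ℤ) * s⁻¹ := by
  obtain ⟨ε, hε⟩ : ∃ ε : ℤ, θ (base m) = g * base m ^ ε * g⁻¹ := by
    have h : θ (base m) ∈ (Subgroup.zpowers (base m)).map (MulAut.conj g).toMonoidHom :=
      hθ ▸ ⟨base m, Subgroup.mem_zpowers _, rfl⟩
    obtain ⟨_, ⟨ε, rfl⟩, h⟩ := h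
    exact ⟨ε, h.symm⟩
  have hunit : IsUnit ε := by
    have h : MulAut.conj g (base m) ∈ (Subgroup.zpowers (base m)).map θ.toMonoidHom :=
      hθ ▸ ⟨base m, Subgroup.mem_zpowers _, rfl⟩
    obtain ⟨_, ⟨l, rfl⟩, h⟩ := h
    change θ (base m ^ l) = g * base m * g⁻¹ at h
    rw [map_zpow, hε, conj_zpow, ← zpow_mul] at h
    have h2 : base m ^ (ε * l) = base m ^ (1 : ℤ) := by simpa using h
    rw [zpow_eq_zpow_iff_modEq, orderOf_base] at h2
    exact IsUnit.of_mul_eq_one l (by simpa using h2)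
  obtain ⟨s, δ, hb, hx⟩ := exists_conj_of_map_base_eq_zpow hm (MulAut.conj g⁻¹ * θ) (ε := ε)
    (by simp [hε, mul_assoc])
  refine ⟨g * s, hunit.unit, δ, ?_, ?_⟩
  · rw [hunit.unit_spec]
    calc θ (base m) = g * (MulAut.conj g⁻¹ * θ) (base m) * g⁻¹ := by simp [mul_assoc]
      _ = _ := by rw [hb]; group
  · calc θ (shift m) = g * (MulAut.conj g⁻¹ * θ) (shift m) * g⁻¹ := by simp [mul_assoc]
      _ = _ := by rw [hx]; group

end CyclicShiftGroup

theorem conj_zpow_eq_of_intCast_eq {G : Type*} [Group G] {m : ℕ} {x b : G}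
    (h : Commute (x ^ m) b) {k l : ℤ} (hkl : (k : ZMod m) = l) :
    x ^ k * b * (x ^ k)⁻¹ = x ^ l * b * (x ^ l)⁻¹ := by
  rw [ZMod.intCast_eq_intCast_iff_dvd_sub] at hkl
  obtain ⟨c, hc⟩ := hkl
  obtain rfl : l = k + m * c := by omega
  have h1 : x ^ ((m : ℤ) * c) * b * (x ^ ((m : ℤ) * c))⁻¹ = b := by
    rw [zpow_mul, zpow_natCast, (h.zpow_left c).eq, mul_inv_cancel_right]
  rw [zpow_add]
  conv_lhs => rw [← h1]
  group

namespace EvenDihedralArtinGroup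

variable (m : ℕ)

theorem commute_mul_pow_bGen : Commute ((aGen m * bGen m) ^ m) (bGen m) := by
  have h : (aGen m * bGen m) ^ m * ((bGen m * aGen m) ^ m)⁻¹ = 1 := by
    have := PresentedGroup.one_of_mem (rels := evenDihedralArtinRels m)
      (x := (FreeGroup.of true * FreeGroup.of false) ^ m *
        ((FreeGroup.of false * FreeGroup.of true) ^ m)⁻¹) rfl
    rw [map_mul, map_inv, map_pow, map_pow, map_mul, map_mul] at this
    exact this
  have h1 : bGen m * aGen m = bGen m * (aGen m * bGen m) * (bGen m)⁻¹ := by group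
  rw [h1, conj_pow, mul_inv_eq_one] at h
  rw [commute_iff_eq]
  conv_lhs => rw [h]
  group

/-- The isomorphism to `CyclicShiftGroup m` taking `b` to `base` and `ab` to `shift`. -/
def toCyclicShiftGroup : EvenDihedralArtinGroup m →* CyclicShiftGroup m :=
  PresentedGroup.toGroup (rels := evenDihedralArtinRels m)
    (f := fun c => cond c (CyclicShiftGroup.shift m * (CyclicShiftGroup.base m)⁻¹)
      (CyclicShiftGroup.base m)) (by
    rintro _ rfl
    have h := CyclicShiftGroup.shift_zpow_mul_self_mem_center (m := m) 1
    rw [mul_one, zpow_natCast, Subgroup.mem_center_iff] at h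
    simp only [map_mul, map_pow, map_inv, FreeGroup.lift_apply_of, cond_true, cond_false,
      inv_mul_cancel_right]
    rw [← mul_assoc, conj_pow, h]
    group)

theorem toCyclicShiftGroup_bGen : toCyclicShiftGroup m (bGen m) = CyclicShiftGroup.base m :=
  PresentedGroup.toGroup.of _

theorem toCyclicShiftGroup_aGen : toCyclicShiftGroup m (aGen m) =
    CyclicShiftGroup.shift m * (CyclicShiftGroup.base m)⁻¹ :=
  PresentedGroup.toGroup.of _

/-- The inverse of `toCyclicShiftGroup`. -/
def ofCyclicShiftGroup : CyclicShiftGroup m →* EvenDihedralArtinGroup m :=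
  SemidirectProduct.lift
    (FreeGroup.lift fun i : ZMod m => (aGen m * bGen m) ^ (i.cast : ℤ) * bGen m *
      ((aGen m * bGen m) ^ (i.cast : ℤ))⁻¹)
    (zpowersHom _ (aGen m * bGen m)) (fun k => by
      ext i
      have hk : cyclicShift m k (FreeGroup.of i) = FreeGroup.of (i + k.toAdd) := rfl
      simp only [MonoidHom.comp_apply, MulEquiv.toMonoidHom_eq_coe, MonoidHom.coe_coe, hk,
        FreeGroup.lift_apply_of, MulAut.conj_apply, zpowersHom_apply]
      rw [conj_zpow_eq_of_intCast_eq (commute_mul_pow_bGen m)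
        (l := k.toAdd + (i.cast : ℤ)) (by simp [add_comm]), zpow_add]
      group)

theorem ofCyclicShiftGroup_base :
    ofCyclicShiftGroup m (CyclicShiftGroup.base m) = bGen m := by
  simp [ofCyclicShiftGroup, CyclicShiftGroup.base]

theorem ofCyclicShiftGroup_shift :
    ofCyclicShiftGroup m (CyclicShiftGroup.shift m) = aGen m * bGen m := by
  simp [ofCyclicShiftGroup, CyclicShiftGroup.shift]

/-- `DA_{2m}` is the semidirect product of a free group of rank `m` with `ℤ` acting by cyclic
shifts of the basis. -/
def equivCyclicShiftGroup : EvenDihedralArtinGroup m ≃* CyclicShiftGroup m :=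
  MonoidHom.toMulEquiv (toCyclicShiftGroup m) (ofCyclicShiftGroup m)
    (by
      apply PresentedGroup.ext
      rintro (_ | _)
      · change ofCyclicShiftGroup m (toCyclicShiftGroup m (bGen m)) = bGen m
        rw [toCyclicShiftGroup_bGen, ofCyclicShiftGroup_base]
      · change ofCyclicShiftGroup m (toCyclicShiftGroup m (aGen m)) = aGen m
        rw [toCyclicShiftGroup_aGen, map_mul, map_inv, ofCyclicShiftGroup_base,
          ofCyclicShiftGroup_shift, mul_inv_cancel_right])
    (by
      apply MonoidHom.eq_of_eqOn_dense (s := {CyclicShiftGroup.base m, CyclicShiftGroup.shift m})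
      · exact CyclicShiftGroup.eq_top_of_mem (Subgroup.subset_closure (by simp))
          (Subgroup.subset_closure (by simp))
      · rintro _ (rfl | rfl)
        · simp [ofCyclicShiftGroup_base, toCyclicShiftGroup_bGen]
        · simp [ofCyclicShiftGroup_shift, toCyclicShiftGroup_bGen, toCyclicShiftGroup_aGen])

theorem equivCyclicShiftGroup_bGen :
    equivCyclicShiftGroup m (bGen m) = CyclicShiftGroup.base m :=
  toCyclicShiftGroup_bGen m

theorem equivCyclicShiftGroup_mul :
    equivCyclicShiftGroup m (aGen m * bGen m) = CyclicShiftGroup.shift m := by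
  change toCyclicShiftGroup m (aGen m * bGen m) = CyclicShiftGroup.shift m
  rw [map_mul, toCyclicShiftGroup_aGen, toCyclicShiftGroup_bGen, inv_mul_cancel_right]

variable {m}

/-- An automorphism of `DA_{2m}` preserving `⟨b⟩` up to conjugation inverts or fixes each of `b`
and `ab`, up to conjugation. -/
theorem exists_conj_of_map_closure (hm : 2 ≤ m) (ψ : MulAut (EvenDihedralArtinGroup m))
    (g : EvenDihedralArtinGroup m)
    (h : Subgroup.map ψ.toMonoidHom (Subgroup.closure {bGen m}) =
      Subgroup.map (MulAut.conj g).toMonoidHom (Subgroup.closure {bGen m})) :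
    ∃ (s : EvenDihedralArtinGroup m) (ε δ : ℤˣ),
      ψ (bGen m) = s * bGen m ^ (ε : ℤ) * s⁻¹ ∧
      ψ (aGen m * bGen m) = s * (aGen m * bGen m) ^ (δ : ℤ) * s⁻¹ := by
  set e := equivCyclicShiftGroup m
  have hb : e (bGen m) = CyclicShiftGroup.base m := equivCyclicShiftGroup_bGen m
  have hx : e (aGen m * bGen m) = CyclicShiftGroup.shift m := equivCyclicShiftGroup_mul m
  let θ : MulAut (CyclicShiftGroup m) := (e.symm.trans ψ).trans e
  have hθ : ∀ y, θ (e y) = e (ψ y) := fun y => by simp [θ]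
  have hmap : (Subgroup.zpowers (CyclicShiftGroup.base m)).map θ.toMonoidHom =
      (Subgroup.zpowers (CyclicShiftGroup.base m)).map (MulAut.conj (e g)).toMonoidHom := by
    have h1 := congrArg (Subgroup.map e.toMonoidHom) h
    rw [← Subgroup.zpowers_eq_closure] at h1
    simp only [MonoidHom.map_zpowers] at h1 ⊢
    rw [← hb]
    change Subgroup.zpowers (θ (e (bGen m))) = Subgroup.zpowers (e g * e (bGen m) * (e g)⁻¹)
    rw [hθ, ← map_mul, ← map_inv, ← map_mul]
    exact h1
  obtain ⟨s, ε, δ, h1, h2⟩ := CyclicShiftGroup.exists_conj_of_map_zpowers hm θ (e g) hmap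
  refine ⟨e.symm s, ε, δ, e.injective ?_, e.injective ?_⟩
  · rw [← hθ, hb, h1]
    simp [hb]
  · rw [← hθ, hx, h2, map_mul, map_mul, map_zpow, hx]
    simp

theorem mulAut_ext {ψ₁ ψ₂ : MulAut (EvenDihedralArtinGroup m)}
    (hb : ψ₁ (bGen m) = ψ₂ (bGen m)) (hx : ψ₁ (aGen m * bGen m) = ψ₂ (aGen m * bGen m)) :
    ψ₁ = ψ₂ := by
  apply MulEquiv.toMonoidHom_injective
  apply PresentedGroup.ext
  rintro (_ | _)
  · exact hb
  · rw [map_mul, map_mul, hb] at hx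
    exact mul_right_cancel hx

end EvenDihedralArtinGroup

/-- If a subgroup `H` of `Out(DA_{2m})` fixes the cyclic subgroup `⟨b⟩` up to conjugation
(every element of `H` has an automorphism representative `ψ` with `ψ(⟨b⟩) = g⟨b⟩g⁻¹` for some
`g`), then `H` is finite. -/
theorem finite_of_fixes_bGen_upToConj (m : ℕ) (hm : 2 ≤ m)
    (H : Subgroup (Out (EvenDihedralArtinGroup m)))
    (hfix : ∀ η ∈ H, ∃ ψ : MulAut (EvenDihedralArtinGroup m),
      (QuotientGroup.mk ψ : Out (EvenDihedralArtinGroup m)) = η ∧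
      ∃ g : EvenDihedralArtinGroup m,
        Subgroup.map ψ.toMonoidHom (Subgroup.closure {bGen m}) =
          Subgroup.map (MulAut.conj g).toMonoidHom (Subgroup.closure {bGen m})) :
    Finite H := by
  have key : ∀ η : H, ∃ (p : ℤˣ × ℤˣ) (ψ : MulAut (EvenDihedralArtinGroup m))
      (s : EvenDihedralArtinGroup m), (QuotientGroup.mk ψ : Out (EvenDihedralArtinGroup m)) = η ∧
      ψ (bGen m) = s * bGen m ^ (p.1 : ℤ) * s⁻¹ ∧
      ψ (aGen m * bGen m) = s * (aGen m * bGen m) ^ (p.2 : ℤ) * s⁻¹ := by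
    intro η
    obtain ⟨ψ, hψ, g, hg⟩ := hfix η η.2
    obtain ⟨s, ε, δ, h⟩ := EvenDihedralArtinGroup.exists_conj_of_map_closure hm ψ g hg
    exact ⟨(ε, δ), ψ, s, hψ, h⟩
  choose p ψ s hψ hb hx using key
  refine Finite.of_injective p fun η₁ η₂ hp => Subtype.ext ?_
  have h : MulAut.conj (s η₂ * (s η₁)⁻¹) * ψ η₁ = ψ η₂ := by
    apply EvenDihedralArtinGroup.mulAut_ext
    · rw [MulAut.mul_apply, MulAut.conj_apply, hb, hb, hp]
      group
    · rw [MulAut.mul_apply, MulAut.conj_apply, hx, hx, hp]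
      group
  have hinner : (QuotientGroup.mk (MulAut.conj (s η₂ * (s η₁)⁻¹)) :
      Out (EvenDihedralArtinGroup m)) = 1 :=
    (QuotientGroup.eq_one_iff _).mpr (MonoidHom.mem_range.mpr ⟨_, rfl⟩)
  rw [← hψ η₁, ← hψ η₂, ← h, QuotientGroup.mk_mul, hinner, one_mul]
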